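/- Let K be a nonempty finite type of classes and M a finite index set of raters. Let π : K → ℝ with π k > 0 for all k, and for each rater m let ℓ m : K → ℝ with ℓ m k > 0 for all k. Define post k = (π k * ∏_{m} ℓ m k) / (∑_{j ∈ K} π j * ∏_{m} ℓ m j). Suppose w : M → K → ℝ is a family of expertness weight vectors such that for every k ∈ K, softmax (fun k => (∑_{m} w m k) + Real.log (π k)) k = post k. Then there exists a constant c ∈ ℝ such that for every k ∈ K, ∑_{m} w m k = (∑_{m} Real.log (ℓ m k)) + c. (This is the necessity direction of Proposition 1: any expertness weights whose softmax fusion with the log-prior reproduces the posterior must agree, in aggregate, with the log-likelihoods up to an additive constant.) -/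

import Mathlib

noncomputable def softmax {K : Type*} [Fintype K] (a : K → ℝ) (k : K) : ℝ :=
  Real.exp (a k) / ∑ j, Real.exp (a j)

theorem stmt_1 {K M : Type*} [Fintype K] [Nonempty K] [Fintype M]
    (pr : K → ℝ) (hpr : ∀ k, 0 < pr k)
    (ℓ : M → K → ℝ) (hℓ : ∀ m k, 0 < ℓ m k)
    (post : K → ℝ)
    (hpost : ∀ k, post k = (pr k * ∏ m, ℓ m k) / (∑ j, pr j * ∏ m, ℓ m j))
    (w : M → K → ℝ)
    (hw : ∀ k, softmax (fun k => (∑ m, w m k) + Real.log (pr k)) k = post k) :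
    ∃ c : ℝ, ∀ k, ∑ m, w m k = (∑ m, Real.log (ℓ m k)) + c := by
  have hP : ∀ k, 0 < ∏ m, ℓ m k := fun k => Finset.prod_pos fun m _ => hℓ m k
  have hS : 0 < ∑ j, Real.exp ((∑ m, w m j) + Real.log (pr j)) :=
    Finset.sum_pos (fun j _ => Real.exp_pos _) Finset.univ_nonempty
  have hZ : 0 < ∑ j, pr j * ∏ m, ℓ m j :=
    Finset.sum_pos (fun j _ => mul_pos (hpr j) (hP j)) Finset.univ_nonempty
  refine ⟨Real.log (∑ j, Real.exp ((∑ m, w m j) + Real.log (pr j)))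
    - Real.log (∑ j, pr j * ∏ m, ℓ m j), fun k => ?_⟩
  have h := hw k
  rw [hpost k] at h
  unfold softmax at h
  have h2 := congrArg Real.log h
  rw [Real.log_div (Real.exp_pos _).ne' hS.ne',
    Real.log_div (mul_pos (hpr k) (hP k)).ne' hZ.ne', Real.log_exp,
    Real.log_mul (hpr k).ne' (hP k).ne',
    Real.log_prod (fun m _ => (hℓ m k).ne')] at h2
  linarith
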